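/- Let m ≥ 1, K ≥ 1, N ≥ 1, t ∈ ℝ, let u : ℤ → ℝ, and for j ∈ ℤ set φ_j := φ^K(t − 2πj/N). Then Σ_{n=0}^{N−1} |u_n · (Δ^m φ)_{n+m}| ≤ (max_{0≤n≤N−1}|u_n|)·(2π/N)^{m−1}·‖(φ^K)^{(m)}‖_{L¹[0,2π]}, where (φ^K)^{(m)} is the m-th derivative of the Dirichlet kernel. -/

import Mathlib

noncomputable section
open Real
open scoped Classical

/-- Backward difference of a sequence. -/
def bdiff (u : ℤ → ℝ) : ℤ → ℝ := fun n => u n - u (n - 1)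

/-- The Dirichlet kernel `φᴷ`. -/
def dirichlet (K : ℕ) (x : ℝ) : ℝ :=
  if ∃ m : ℤ, x = 2 * π * m then 2 * K + 1
  else Real.sin ((2 * K + 1) * x / 2) / Real.sin (x / 2)

theorem bdiff_iterate_sample (f : ℝ → ℝ) (s h : ℝ) (m : ℕ) (j : ℤ) :
    bdiff^[m] (fun i : ℤ => f (s - h * i)) j = (-1) ^ m * ((fwdDiff h)^[m] f) (s - h * j) := by
  induction m generalizing j with
  | zero => simp
  | succ m ih =>
    rw [Function.iterate_succ_apply', Function.iterate_succ_apply', bdiff, ih, ih, fwdDiff]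
    have e : s - h * ((j - 1 : ℤ) : ℝ) = s - h * j + h := by push_cast; ring
    rw [e]
    ring

theorem contDiff_fwdDiff {n : WithTop ℕ∞} {f : ℝ → ℝ} (hf : ContDiff ℝ n f) (h : ℝ) :
    ContDiff ℝ n (fwdDiff h f) := by
  unfold fwdDiff
  exact (hf.comp (contDiff_id.add contDiff_const)).sub hf

theorem contDiff_fwdDiff_iterate {n : WithTop ℕ∞} {f : ℝ → ℝ} (hf : ContDiff ℝ n f) (h : ℝ)
    (m : ℕ) : ContDiff ℝ n ((fwdDiff h)^[m] f) := by
  induction m with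
  | zero => exact hf
  | succ m ih => rw [Function.iterate_succ_apply']; exact contDiff_fwdDiff ih h

theorem deriv_fwdDiff {f : ℝ → ℝ} (hf : Differentiable ℝ f) (h : ℝ) :
    deriv (fwdDiff h f) = fwdDiff h (deriv f) := by
  ext x
  exact (((hf (x + h)).hasDerivAt.comp_add_const x h).sub (hf x).hasDerivAt).deriv

theorem deriv_fwdDiff_iterate {f : ℝ → ℝ} (hf : ContDiff ℝ 1 f) (h : ℝ) (m : ℕ) :
    deriv ((fwdDiff h)^[m] f) = (fwdDiff h)^[m] (deriv f) := by
  induction m with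
  | zero => rfl
  | succ m ih =>
    rw [Function.iterate_succ_apply', Function.iterate_succ_apply', ← ih]
    exact deriv_fwdDiff ((contDiff_fwdDiff_iterate hf h m).differentiable one_ne_zero) h

/-- The forward difference is the integral of the derivative. -/
theorem fwdDiff_eq_integral {f : ℝ → ℝ} (hf : ContDiff ℝ 1 f) (h x : ℝ) :
    fwdDiff h f x = ∫ r in x..(x + h), deriv f r :=
  (intervalIntegral.integral_deriv_eq_sub
    (fun y _ => hf.differentiable one_ne_zero y)
    ((hf.continuous_deriv le_rfl).intervalIntegrable _ _)).symm

theorem periodic_deriv {f : ℝ → ℝ} {T : ℝ} (hf : Function.Periodic f T) :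
    Function.Periodic (deriv f) T := fun x => by
  rw [← deriv_comp_add_const]
  congr 1
  exact funext hf

theorem sum_abs_fwdDiff_le {f : ℝ → ℝ} (hf : ContDiff ℝ 1 f) {h : ℝ} (hh : 0 ≤ h) (N : ℕ)
    (hp : Function.Periodic f (N * h)) (s : ℝ) :
    ∑ n ∈ Finset.range N, |fwdDiff h f (s - h * n)| ≤ ∫ x in (0 : ℝ)..(N * h), |deriv f x| := by
  have hc : Continuous fun x => |deriv f x| := (hf.continuous_deriv le_rfl).abs
  have hper : Function.Periodic (fun x => |deriv f x|) (N * h) := fun x => by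
    simp only [periodic_deriv hp x]
  calc ∑ n ∈ Finset.range N, |fwdDiff h f (s - h * n)|
      ≤ ∑ n ∈ Finset.range N,
          -∫ x in (s + h - h * n)..(s + h - h * (n + 1 : ℕ)), |deriv f x| := by
        refine Finset.sum_le_sum fun n _ => ?_
        rw [fwdDiff_eq_integral hf, ← intervalIntegral.integral_symm]
        have e₁ : s + h - h * (n + 1 : ℕ) = s - h * n := by push_cast; ring
        have e₂ : s + h - h * n = s - h * n + h := by ring
        rw [e₁, e₂]
        exact intervalIntegral.abs_integral_le_integral_abs (by linarith)
    _ = ∫ x in (s + h - N * h)..(s + h - N * h + N * h), |deriv f x| := by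
        rw [Finset.sum_neg_distrib, intervalIntegral.sum_integral_adjacent_intervals
          (a := fun n : ℕ => s + h - h * n) fun n _ => hc.intervalIntegrable _ _,
          ← intervalIntegral.integral_symm]
        congr 1 <;> push_cast <;> ring
    _ = ∫ x in (0 : ℝ)..(N * h), |deriv f x| := by
        rw [hper.intervalIntegral_add_eq _ 0, zero_add]

theorem sum_abs_fwdDiff_iterate_le {f : ℝ → ℝ} {h : ℝ} (hh : 0 ≤ h) (N m : ℕ)
    (hf : ContDiff ℝ (m + 1 : ℕ) f) (hp : Function.Periodic f (N * h)) (s : ℝ) :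
    ∑ n ∈ Finset.range N, |((fwdDiff h)^[m + 1] f) (s - h * n)| ≤
      h ^ m * ∫ x in (0 : ℝ)..(N * h), |iteratedDeriv (m + 1) f x| := by
  induction m generalizing f s with
  | zero => simpa using sum_abs_fwdDiff_le (by simpa using hf) hh N hp s
  | succ m ih =>
    have hf1 : ContDiff ℝ 1 f := hf.of_le (by exact_mod_cast Nat.le_add_left 1 (m + 1))
    have hd : ContDiff ℝ (m + 1 : ℕ) (deriv f) := by
      have hf' : ContDiff ℝ ((m + 1 : ℕ) + 1) f := by exact_mod_cast hf
      exact (contDiff_succ_iff_deriv.1 hf').2.2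
    set g := (fwdDiff h)^[m + 1] (deriv f) with hg
    have hgc : Continuous g := (contDiff_fwdDiff_iterate hd h (m + 1)).continuous
    have hi (n : ℕ) : Continuous fun r : ℝ => |g (s + r - h * n)| := by fun_prop
    calc ∑ n ∈ Finset.range N, |((fwdDiff h)^[m + 1 + 1] f) (s - h * n)|
        ≤ ∑ n ∈ Finset.range N, ∫ r in (0 : ℝ)..h, |g (s + r - h * n)| := by
          refine Finset.sum_le_sum fun n _ => ?_
          rw [Function.iterate_succ_apply',
            fwdDiff_eq_integral (contDiff_fwdDiff_iterate hf1 h (m + 1)),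
            deriv_fwdDiff_iterate hf1]
          refine (intervalIntegral.abs_integral_le_integral_abs (by linarith)).trans_eq ?_
          have e := intervalIntegral.integral_comp_add_right (a := 0) (b := h)
            (fun x => |g x|) (s - h * n)
          rw [zero_add, add_comm h] at e
          rw [← e]
          congr 1
          ext r
          congr 2
          ring
      _ = ∫ r in (0 : ℝ)..h, ∑ n ∈ Finset.range N, |g (s + r - h * n)| :=
          (intervalIntegral.integral_finsetSum
            fun n _ => (hi n).intervalIntegrable _ _).symm
      _ ≤ ∫ _ in (0 : ℝ)..h,
            h ^ m * ∫ x in (0 : ℝ)..(N * h), |iteratedDeriv (m + 1) (deriv f) x| := by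
          refine intervalIntegral.integral_mono_on hh
            ((continuous_finsetSum _ fun n _ => hi n).intervalIntegrable _ _)
            (continuous_const.intervalIntegrable _ _) fun r _ => ?_
          exact ih hd (periodic_deriv hp) (s + r)
      _ = h ^ (m + 1) * ∫ x in (0 : ℝ)..(N * h), |iteratedDeriv (m + 1 + 1) f x| := by
          rw [intervalIntegral.integral_const, iteratedDeriv_succ' (n := m + 1), smul_eq_mul]
          ring

theorem sin_half_mul_sum_cos (K : ℕ) (x : ℝ) :
    Real.sin (x / 2) * (1 + 2 * ∑ k ∈ Finset.range K, Real.cos ((k + 1 : ℕ) * x)) =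
      Real.sin ((2 * K + 1) * x / 2) := by
  induction K with
  | zero => simp
  | succ K ih =>
    rw [Finset.sum_range_succ, mul_add (2 : ℝ), ← add_assoc, mul_add, ih]
    have e₁ : (2 * (K : ℝ) + 1) * x / 2 = (K + 1 : ℕ) * x - x / 2 := by push_cast; ring
    have e₂ : (2 * ((K + 1 : ℕ) : ℝ) + 1) * x / 2 = (K + 1 : ℕ) * x + x / 2 := by ring
    rw [e₁, e₂, Real.sin_sub, Real.sin_add]
    ring

theorem dirichlet_eq_sum_cos (K : ℕ) :
    dirichlet K = fun x => 1 + 2 * ∑ k ∈ Finset.range K, Real.cos ((k + 1 : ℕ) * x) := by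
  ext x
  unfold dirichlet
  split_ifs with hx
  · obtain ⟨m, rfl⟩ := hx
    have e (k : ℕ) : Real.cos ((k + 1 : ℕ) * (2 * π * m)) = 1 := by
      rw [← Real.cos_int_mul_two_pi ((k + 1 : ℕ) * m)]
      congr 1
      push_cast
      ring
    simp only [e, Finset.sum_const, Finset.card_range, nsmul_eq_mul]
    ring
  · have hs : Real.sin (x / 2) ≠ 0 := fun h0 => by
      obtain ⟨m, hm⟩ := Real.sin_eq_zero_iff.1 h0
      exact hx ⟨m, by linarith⟩
    rw [div_eq_iff hs, ← sin_half_mul_sum_cos, mul_comm]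

theorem contDiff_dirichlet (K : ℕ) {n : WithTop ℕ∞} : ContDiff ℝ n (dirichlet K) := by
  rw [dirichlet_eq_sum_cos]
  exact contDiff_const.add (contDiff_const.mul (ContDiff.sum fun k _ =>
    Real.contDiff_cos.comp (contDiff_const.mul contDiff_id)))

theorem periodic_dirichlet (K : ℕ) : Function.Periodic (dirichlet K) (2 * π) := fun x => by
  simp only [dirichlet_eq_sum_cos, mul_add, Real.cos_add_nat_mul_two_pi]

/-- **Main-term estimate in the `m`-th order error analysis.**
With `φⱼ := φᴷ(t - 2πj/N)`,
`∑_{n=0}^{N-1} |uₙ (Δᵐφ)_{n+m}| ≤ (maxₙ|uₙ|)·(2π/N)^{m-1}·‖(φᴷ)⁽ᵐ⁾‖_{L¹[0,2π]}`. -/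
theorem main_term_estimate (m K N : ℕ) (hm : 1 ≤ m) (hK : 1 ≤ K) (hN : 1 ≤ N)
    (t : ℝ) (u : ℤ → ℝ) :
    ∑ n ∈ Finset.range N,
        |u n * (bdiff^[m] (fun j : ℤ => dirichlet K (t - 2 * π * j / N))) ((n : ℤ) + m)| ≤
      (⨆ n : Fin N, |u ((n : ℕ) : ℤ)|) * (2 * π / N) ^ (m - 1) *
        ∫ x in (0 : ℝ)..(2 * π), |iteratedDeriv m (dirichlet K) x| := by
  obtain ⟨m, rfl⟩ := Nat.exists_eq_add_of_le' hm
  have hN0 : (N : ℝ) ≠ 0 := by positivity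
  set h : ℝ := 2 * π / N with hh
  have h0 : 0 ≤ h := by positivity
  have hNh : N * h = 2 * π := by rw [hh]; field_simp
  have hseq : (fun j : ℤ => dirichlet K (t - 2 * π * j / N)) =
      fun j : ℤ => dirichlet K (t - h * j) := by
    ext j
    rw [hh, div_mul_eq_mul_div]
  have hkey := sum_abs_fwdDiff_iterate_le h0 N m (contDiff_dirichlet K)
    (hNh ▸ periodic_dirichlet K) (t - h * (m + 1 : ℕ))
  rw [hNh] at hkey
  rw [hseq, Nat.add_sub_cancel, mul_assoc]
  refine le_trans ?_ (mul_le_mul_of_nonneg_left hkey (Real.iSup_nonneg fun _ => abs_nonneg _))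
  rw [Finset.mul_sum]
  refine Finset.sum_le_sum fun n hn => ?_
  rw [abs_mul, bdiff_iterate_sample, abs_mul, abs_pow, abs_neg, abs_one, one_pow, one_mul]
  have e : t - h * (((n : ℤ) + (m + 1 : ℕ) : ℤ) : ℝ) = t - h * (m + 1 : ℕ) - h * n := by
    push_cast
    ring
  rw [e]
  exact mul_le_mul_of_nonneg_right
    (le_ciSup (f := fun n : Fin N => |u ((n : ℕ) : ℤ)|) (Set.finite_range _).bddAbove
      ⟨n, Finset.mem_range.1 hn⟩) (abs_nonneg _)
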